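/- arXiv:1305.5468 — 10 statements merged into one kernel-verified Lean document; each statement's English description precedes it below -/
import Mathlib

section
/- Consider an m×2^n matrix game (m ≥ 2, n ≥ 1) in which player I's pure strategies are i ∈ {0,1,...,m−1} and player II's pure strategies are the subsets T ⊆ {1,2,...,n}, and suppose that for each i there are reals p_i(0) ≥ 0, p_i(1) > 0, ..., p_i(n) > 0 with p_i(0)+p_i(1)+···+p_i(n) = 1, a real a_i(0), and reals a_{i,0}(l), a_{i,1}(l) for l = 1,...,n, such that the payoff (to player I) is a_{i,T} := p_i(0)a_i(0) + Σ_{l∈T} p_i(l)a_{i,1}(l) + Σ_{l∈T^c} p_i(l)a_{i,0}(l). Define T_1 := {1 ≤ l ≤ n : a_{i,0}(l) > a_{i,1}(l) for all i}, T_0 := {1 ≤ l ≤ n : a_{i,0}(l) < a_{i,1}(l) for all i}, and T_* := {1,...,n} − T_0 − T_1. Then every subset T ⊆ {1,...,n} that does not satisfy T_1 ⊆ T ⊆ T_1 ∪ T_* is strictly dominated for player II: there exists a subset T' ⊆ {1,...,n} such that a_{i,T'} < a_{i,T} for every i ∈ {0,1,...,m−1}. -/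
open scoped Classical

/-- Effect of inserting `a` into `s` on a sum that uses `f` on `s` and `g` on the complement. -/
theorem Finset.sum_insert_add_sum_compl_insert {ι M : Type*} [Fintype ι] [DecidableEq ι]
    [AddCommMonoid M] (f g : ι → M) {s : Finset ι} {a : ι} (ha : a ∉ s) :
    ∑ l ∈ insert a s, f l + ∑ l ∈ (insert a s)ᶜ, g l + g a
      = ∑ l ∈ s, f l + ∑ l ∈ sᶜ, g l + f a := by
  rw [Finset.sum_insert ha, Finset.compl_insert, add_assoc,
    Finset.sum_erase_add _ _ (Finset.mem_compl.2 ha)]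
  abel

/-- Lemma 1 of Ethier–Gámez: in the `m × 2^n` matrix game with payoffs
`a_{i,T} = p_i(0)a_i(0) + ∑_{l∈T} p_i(l)a_{i,1}(l) + ∑_{l∈Tᶜ} p_i(l)a_{i,0}(l)`,
every column `T` with `¬(T₁ ⊆ T ⊆ T₁ ∪ T_*)` is strictly dominated for player II. -/
theorem stmt_0 (m n : ℕ) (hm : 2 ≤ m) (hn : 1 ≤ n)
    (p0 : Fin m → ℝ) (p : Fin m → Fin n → ℝ)
    (a0 : Fin m → ℝ) (aa : Fin m → Fin 2 → Fin n → ℝ)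
    (hp0 : ∀ i, 0 ≤ p0 i) (hp : ∀ i l, 0 < p i l)
    (hsum : ∀ i, p0 i + ∑ l, p i l = 1)
    (payoff : Fin m → Finset (Fin n) → ℝ)
    (hpayoff : ∀ i T, payoff i T
      = p0 i * a0 i + ∑ l ∈ T, p i l * aa i 1 l + ∑ l ∈ Tᶜ, p i l * aa i 0 l)
    (T1 T0 Tstar : Finset (Fin n))
    (hT1 : T1 = Finset.univ.filter fun l => ∀ i, aa i 1 l < aa i 0 l)
    (hT0 : T0 = Finset.univ.filter fun l => ∀ i, aa i 0 l < aa i 1 l)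
    (hTstar : Tstar = Finset.univ \ (T0 ∪ T1)) :
    ∀ T : Finset (Fin n), ¬ (T1 ⊆ T ∧ T ⊆ T1 ∪ Tstar) →
      ∃ T' : Finset (Fin n), ∀ i, payoff i T' < payoff i T := by
  intro T hT
  have payoff_insert (i) {S : Finset (Fin n)} {l : Fin n} (hl : l ∉ S) :
      payoff i (insert l S) + p i l * aa i 0 l = payoff i S + p i l * aa i 1 l := by
    have := Finset.sum_insert_add_sum_compl_insert
      (fun l => p i l * aa i 1 l) (fun l => p i l * aa i 0 l) hl
    rw [hpayoff, hpayoff]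
    linarith
  rcases not_and_or.1 hT with h | h
  · obtain ⟨l, hl1, hlT⟩ := Finset.not_subset.1 h
    refine ⟨insert l T, fun i => ?_⟩
    have hlt : aa i 1 l < aa i 0 l := by
      rw [hT1, Finset.mem_filter] at hl1
      exact hl1.2 i
    linarith [payoff_insert i hlT, mul_lt_mul_of_pos_left hlt (hp i l)]
  · obtain ⟨l, hlT, hl⟩ := Finset.not_subset.1 h
    have hl0 : l ∈ T0 := by
      simp only [hTstar, Finset.mem_union, Finset.mem_sdiff, Finset.mem_univ] at hl
      tauto
    refine ⟨T.erase l, fun i => ?_⟩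
    have hlt : aa i 0 l < aa i 1 l := by
      rw [hT0, Finset.mem_filter] at hl0
      exact hl0.2 i
    have hins := payoff_insert i (Finset.notMem_erase l T)
    rw [Finset.insert_erase hlT] at hins
    linarith [mul_lt_mul_of_pos_left hlt (hp i l)]
end

section
/- Consider a 2×2^n matrix game (n ≥ 1) in which player I's pure strategies are i ∈ {0,1}, player II's pure strategies are the subsets T ⊆ {1,...,n}, and the payoff to player I is a_{i,T} := e_i(0) + Σ_{l∈T} e_{i,1}(l) + Σ_{l∈T^c} e_{i,0}(l) for given reals e_0(0), e_1(0) and e_{i,j}(l) (i,j ∈ {0,1}, l = 1,...,n). Define T_{00} := {l : e_{0,0}(l) < e_{0,1}(l) and e_{1,0}(l) < e_{1,1}(l)}, T_{01} := {l : e_{0,0}(l) < e_{0,1}(l) and e_{1,0}(l) > e_{1,1}(l)}, T_{10} := {l : e_{0,0}(l) > e_{0,1}(l) and e_{1,0}(l) < e_{1,1}(l)}, T_{11} := {l : e_{0,0}(l) > e_{0,1}(l) and e_{1,0}(l) > e_{1,1}(l)}, and assume T_{00} ∪ T_{01} ∪ T_{10} ∪ T_{11} = {1,...,n}. For p ∈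 [0,1] set p(l) := (e_{0,0}(l) − e_{0,1}(l)) / (e_{0,0}(l) − e_{0,1}(l) + e_{1,1}(l) − e_{1,0}(l)) and T(p) := T_{11} ∪ {l ∈ T_{01} : p(l) < p} ∪ {l ∈ T_{10} : p(l) > p}. Then T(p) is a best response of player II to player I's mixed strategy (1−p, p): for every subset T ⊆ {1,...,n}, (1−p)a_{0,T(p)} + p·a_{1,T(p)} ≤ (1−p)a_{0,T} + p·a_{1,T}. -/
open scoped Classical

/-- Choosing between `f` and `g` index by index, a set that always picks the smaller one
minimizes the total. -/
theorem Finset.sum_add_sum_compl_le_of_pointwise {ι : Type*} [Fintype ι] [DecidableEq ι]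
    {f g : ι → ℝ} {S : Finset ι} (hin : ∀ l ∈ S, f l ≤ g l) (hout : ∀ l ∉ S, g l ≤ f l)
    (T : Finset ι) :
    ∑ l ∈ S, f l + ∑ l ∈ Sᶜ, g l ≤ ∑ l ∈ T, f l + ∑ l ∈ Tᶜ, g l := by
  have key : ∀ U : Finset ι,
      ∑ l ∈ U, f l + ∑ l ∈ Uᶜ, g l = ∑ l, if l ∈ U then f l else g l := by
    intro U
    rw [← Finset.sum_add_sum_compl U]
    congr 1
    · exact Finset.sum_congr rfl fun l hl => by simp [hl]
    · exact Finset.sum_congr rfl fun l hl => by simp [Finset.mem_compl.mp hl]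
  rw [key, key]
  refine Finset.sum_le_sum fun l _ => ?_
  by_cases hS : l ∈ S
  · have := hin l hS
    split_ifs <;> simp_all
  · have := hout l hS
    split_ifs <;> simp_all

/-- Foster's algorithm best-response lemma: in the `2 × 2^n` matrix game with payoffs
`a_{i,T} = e_i(0) + ∑_{l∈T} e_{i,1}(l) + ∑_{l∈Tᶜ} e_{i,0}(l)`, if
`T₀₀ ∪ T₀₁ ∪ T₁₀ ∪ T₁₁ = {1,…,n}` then `T(p)` is a best response of player II to
player I's mixed strategy `(1−p, p)`. -/
theorem stmt_1 (n : ℕ) (hn : 1 ≤ n)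
    (e0 : Fin 2 → ℝ) (e : Fin 2 → Fin 2 → Fin n → ℝ)
    (payoff : Fin 2 → Finset (Fin n) → ℝ)
    (hpayoff : ∀ i T, payoff i T
      = e0 i + ∑ l ∈ T, e i 1 l + ∑ l ∈ Tᶜ, e i 0 l)
    (T00 T01 T10 T11 : Finset (Fin n))
    (hT00 : T00 = Finset.univ.filter fun l => e 0 0 l < e 0 1 l ∧ e 1 0 l < e 1 1 l)
    (hT01 : T01 = Finset.univ.filter fun l => e 0 0 l < e 0 1 l ∧ e 1 1 l < e 1 0 l)
    (hT10 : T10 = Finset.univ.filter fun l => e 0 1 l < e 0 0 l ∧ e 1 0 l < e 1 1 l)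
    (hT11 : T11 = Finset.univ.filter fun l => e 0 1 l < e 0 0 l ∧ e 1 1 l < e 1 0 l)
    (hcover : T00 ∪ T01 ∪ T10 ∪ T11 = Finset.univ)
    (pl : Fin n → ℝ)
    (hpl : ∀ l, pl l = (e 0 0 l - e 0 1 l)
      / (e 0 0 l - e 0 1 l + e 1 1 l - e 1 0 l))
    (p : ℝ) (hp : p ∈ Set.Icc (0 : ℝ) 1)
    (Tp : Finset (Fin n))
    (hTp : Tp = T11 ∪ (T01.filter fun l => pl l < p) ∪ (T10.filter fun l => p < pl l)) :
    ∀ T : Finset (Fin n),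
      (1 - p) * payoff 0 Tp + p * payoff 1 Tp
        ≤ (1 - p) * payoff 0 T + p * payoff 1 T := by
  intro T
  have mix : ∀ U : Finset (Fin n), (1 - p) * payoff 0 U + p * payoff 1 U
      = ((1 - p) * e0 0 + p * e0 1)
        + (∑ l ∈ U, ((1 - p) * e 0 1 l + p * e 1 1 l)
          + ∑ l ∈ Uᶜ, ((1 - p) * e 0 0 l + p * e 1 0 l)) := by
    intro U
    simp only [hpayoff, Finset.sum_add_distrib, ← Finset.mul_sum]
    ring
  have mem_iff : ∀ l, l ∈ Tp ↔ (e 0 1 l < e 0 0 l ∧ e 1 1 l < e 1 0 l)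
      ∨ ((e 0 0 l < e 0 1 l ∧ e 1 1 l < e 1 0 l) ∧ pl l < p)
      ∨ ((e 0 1 l < e 0 0 l ∧ e 1 0 l < e 1 1 l) ∧ p < pl l) := by
    intro l
    simp [hTp, hT11, hT01, hT10]
  have pl_lt : ∀ l, e 0 0 l < e 0 1 l → e 1 1 l < e 1 0 l →
      (pl l < p ↔ (1 - p) * e 0 1 l + p * e 1 1 l < (1 - p) * e 0 0 l + p * e 1 0 l) := by
    intro l h0 h1
    rw [hpl, div_lt_iff_of_neg (by linarith)]
    constructor <;> intro h <;> linarith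
  have lt_pl : ∀ l, e 0 1 l < e 0 0 l → e 1 0 l < e 1 1 l →
      (p < pl l ↔ (1 - p) * e 0 1 l + p * e 1 1 l < (1 - p) * e 0 0 l + p * e 1 0 l) := by
    intro l h0 h1
    rw [hpl, lt_div_iff₀ (by linarith)]
    constructor <;> intro h <;> linarith
  have hp0 : 0 ≤ p := hp.1
  have hp1 : 0 ≤ 1 - p := sub_nonneg.mpr hp.2
  rw [mix, mix]
  refine add_le_add_right (Finset.sum_add_sum_compl_le_of_pointwise ?_ ?_ T) _
  · intro l hl
    rcases (mem_iff l).mp hl with ⟨h0, h1⟩ | ⟨⟨h0, h1⟩, h⟩ | ⟨⟨h0, h1⟩, h⟩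
    · gcongr
    · exact ((pl_lt l h0 h1).mp h).le
    · exact ((lt_pl l h0 h1).mp h).le
  · intro l hl
    rw [mem_iff] at hl
    push Not at hl
    obtain ⟨h11, h01, h10⟩ := hl
    have hc : l ∈ T00 ∪ T01 ∪ T10 ∪ T11 := hcover ▸ Finset.mem_univ l
    simp only [hT00, hT01, hT10, hT11, Finset.mem_union, Finset.mem_filter, Finset.mem_univ,
      true_and] at hc
    rcases hc with ((⟨h0, h1⟩ | ⟨h0, h1⟩) | ⟨h0, h1⟩) | ⟨h0, h1⟩
    · gcongr
    · exact not_lt.mp fun h => (h01 ⟨h0, h1⟩).not_gt ((pl_lt l h0 h1).mpr h)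
    · exact not_lt.mp fun h => (h10 ⟨h0, h1⟩).not_gt ((lt_pl l h0 h1).mpr h)
    · exact absurd h1 (not_lt.mpr (h11 h0))
end

section
/- In the setting of the 2×2^n matrix game of Foster's algorithm with payoffs a_{i,T} := e_i(0) + Σ_{l∈T} e_{i,1}(l) + Σ_{l∈T^c} e_{i,0}(l) and with T_{00} ∪ T_{01} ∪ T_{10} ∪ T_{11} = {1,...,n}, define V(p) := min over subsets T ⊆ {1,...,n} of (1−p)a_{0,T} + p·a_{1,T} for p ∈ [0,1], and p(l) := (e_{0,0}(l) − e_{0,1}(l)) / (e_{0,0}(l) − e_{0,1}(l) + e_{1,1}(l) − e_{1,0}(l)) for l ∈ T_{01} ∪ T_{10}. Then the value of the game satisfies max_{0≤p≤1} V(p) = max( V(0), V(1), max_{l ∈ T_{01} ∪ T_{10}} V(p(l)) ). -/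
open scoped Classical

/-- A continuous function without zeros in `(a, b)` that is nonpositive somewhere in `(a, b)` is
nonpositive at both end points. -/
theorem nonpos_endpoints_of_ne_zero {f : ℝ → ℝ} (hf : Continuous f) {a b p : ℝ}
    (hap : a < p) (hpb : p < b) (hne : ∀ q, a < q → q < b → f q ≠ 0) (hp : f p ≤ 0) :
    f a ≤ 0 ∧ f b ≤ 0 := by
  constructor
  · by_contra! h
    obtain ⟨q, hq, hq0⟩ := intermediate_value_Icc' hap.le hf.continuousOn ⟨hp, h.le⟩
    have haq : a ≠ q := by rintro rfl; exact h.ne' hq0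
    exact hne q (lt_of_le_of_ne hq.1 haq) (hq.2.trans_lt hpb) hq0
  · by_contra! h
    obtain ⟨q, hq, hq0⟩ := intermediate_value_Icc hpb.le hf.continuousOn ⟨hp, h.le⟩
    have hqb : q ≠ b := by rintro rfl; exact h.ne' hq0
    exact hne q (hap.trans_le hq.1) (lt_of_le_of_ne hq.2 hqb) hq0

/-- A subset containing only nonpositive terms and missing only nonnegative ones has the smallest
partial sum. -/
theorem sum_le_sum_of_sign {ι : Type*} [Fintype ι] [DecidableEq ι] {d : ι → ℝ} {T : Finset ι}
    (hT : ∀ l ∈ T, d l ≤ 0) (hTc : ∀ l ∉ T, 0 ≤ d l) (T' : Finset ι) :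
    ∑ l ∈ T, d l ≤ ∑ l ∈ T', d l := by
  rw [← Finset.sum_ite_mem_eq T, ← Finset.sum_ite_mem_eq T']
  refine Finset.sum_le_sum fun l _ => ?_
  by_cases h : l ∈ T <;> by_cases h' : l ∈ T' <;> simp [h, h', hT, hTc]

/-- An affine function takes, at a point of `[a, b]`, at most the larger of its end values. -/
theorem affine_le_max_endpoints (u v : ℝ) {a b p : ℝ} (hap : a ≤ p) (hpb : p ≤ b) :
    (1 - p) * u + p * v ≤ max ((1 - a) * u + a * v) ((1 - b) * u + b * v) := by
  rcases le_total u v with h | h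
  · exact le_max_of_le_right (by nlinarith)
  · exact le_max_of_le_left (by nlinarith)

/-- A zero in `[0, 1]` of the segment from a nonzero `x` to a nonzero `y` forces opposite signs and
is given by the breakpoint formula. -/
theorem opposite_signs_of_segment_eq_zero {x y q : ℝ} (hx : x ≠ 0) (hy : y ≠ 0)
    (h0 : 0 ≤ q) (h1 : q ≤ 1) (hq : (1 - q) * x + q * y = 0) :
    (0 < x ∧ y < 0 ∨ x < 0 ∧ 0 < y) ∧ q = -x / (-x + y) := by
  have hq0 : 0 < q := lt_of_le_of_ne h0 (by rintro rfl; exact hx (by linarith))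
  have hxy : 0 < x ∧ y < 0 ∨ x < 0 ∧ 0 < y := by
    rcases lt_or_gt_of_ne hx with hx | hx <;> rcases lt_or_gt_of_ne hy with hy | hy
    · linarith [mul_neg_of_pos_of_neg hq0 hy,
        mul_nonpos_of_nonneg_of_nonpos (sub_nonneg.2 h1) hx.le]
    · exact Or.inr ⟨hx, hy⟩
    · exact Or.inl ⟨hx, hy⟩
    · linarith [mul_pos hq0 hy, mul_nonneg (sub_nonneg.2 h1) hx.le]
  refine ⟨hxy, ?_⟩
  have hne : -x + y ≠ 0 := by rcases hxy with h | h <;> [apply ne_of_lt; apply ne_of_gt] <;> linarith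
  rw [eq_div_iff hne]
  linarith

/-- The breakpoint of a segment with end values of opposite signs lies in `[0, 1]`. -/
theorem breakpoint_mem_Icc {x y : ℝ} (h : 0 < x ∧ y < 0 ∨ x < 0 ∧ 0 < y) :
    -x / (-x + y) ∈ Set.Icc (0 : ℝ) 1 := by
  rcases h with ⟨hx, hy⟩ | ⟨hx, hy⟩
  · exact ⟨div_nonneg_of_nonpos (by linarith) (by linarith),
      (div_le_one_of_neg (by linarith)).2 (by linarith)⟩
  · exact ⟨div_nonneg (by linarith) (by linarith), (div_le_one (by linarith)).2 (by linarith)⟩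

/-- In Foster's `2 × 2^n` matrix game, the lower envelope
`V(p) = min_T ((1−p)a_{0,T} + p a_{1,T})` attains its maximum over `p ∈ [0,1]` at `0`, `1`,
or one of the breakpoints `p(l)`, `l ∈ T₀₁ ∪ T₁₀`:
`max_{0≤p≤1} V(p) = max(V(0), V(1), max_{l∈T₀₁∪T₁₀} V(p(l)))`. -/
theorem stmt_2 (n : ℕ) (hn : 1 ≤ n)
    (e0 : Fin 2 → ℝ) (e : Fin 2 → Fin 2 → Fin n → ℝ)
    (payoff : Fin 2 → Finset (Fin n) → ℝ)
    (hpayoff : ∀ i T, payoff i T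
      = e0 i + ∑ l ∈ T, e i 1 l + ∑ l ∈ Tᶜ, e i 0 l)
    (T00 T01 T10 T11 : Finset (Fin n))
    (hT00 : T00 = Finset.univ.filter fun l => e 0 0 l < e 0 1 l ∧ e 1 0 l < e 1 1 l)
    (hT01 : T01 = Finset.univ.filter fun l => e 0 0 l < e 0 1 l ∧ e 1 1 l < e 1 0 l)
    (hT10 : T10 = Finset.univ.filter fun l => e 0 1 l < e 0 0 l ∧ e 1 0 l < e 1 1 l)
    (hT11 : T11 = Finset.univ.filter fun l => e 0 1 l < e 0 0 l ∧ e 1 1 l < e 1 0 l)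
    (hcover : T00 ∪ T01 ∪ T10 ∪ T11 = Finset.univ)
    (pl : Fin n → ℝ)
    (hpl : ∀ l, pl l = (e 0 0 l - e 0 1 l)
      / (e 0 0 l - e 0 1 l + e 1 1 l - e 1 0 l))
    (V : ℝ → ℝ)
    (hV : ∀ p, V p = Finset.univ.inf' Finset.univ_nonempty
      (fun T : Finset (Fin n) => (1 - p) * payoff 0 T + p * payoff 1 T)) :
    IsGreatest (V '' Set.Icc (0 : ℝ) 1)
      ((insert (0 : ℝ) (insert 1 ((T01 ∪ T10).image pl))).sup'
        (Finset.insert_nonempty _ _) V) := by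
  set d : Fin n → ℝ → ℝ := fun l q => (1 - q) * (e 0 1 l - e 0 0 l) + q * (e 1 1 l - e 1 0 l)
    with hd
  set S : Finset ℝ := insert (0 : ℝ) (insert 1 ((T01 ∪ T10).image pl)) with hS
  have hpl' : ∀ l, pl l = -(e 0 1 l - e 0 0 l) /
      (-(e 0 1 l - e 0 0 l) + (e 1 1 l - e 1 0 l)) := fun l => by
    rw [hpl]; congr 1 <;> ring
  have hbreak : ∀ l, l ∈ T01 ∪ T10 ↔ (0 < e 0 1 l - e 0 0 l ∧ e 1 1 l - e 1 0 l < 0 ∨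
      e 0 1 l - e 0 0 l < 0 ∧ 0 < e 1 1 l - e 1 0 l) := fun l => by
    simp [hT01, hT10]
  have hS01 : ∀ q ∈ S, q ∈ Set.Icc (0 : ℝ) 1 := by
    intro q hq
    simp only [hS, Finset.mem_insert, Finset.mem_image] at hq
    rcases hq with rfl | rfl | ⟨l, hl, rfl⟩
    · simp
    · simp
    · rw [hpl']
      exact breakpoint_mem_Icc ((hbreak l).1 hl)
  have hzero : ∀ l q, 0 ≤ q → q ≤ 1 → d l q = 0 → q ∈ S := by
    intro l q h0 h1 hq
    have hl : l ∈ T00 ∪ T01 ∪ T10 ∪ T11 := hcover ▸ Finset.mem_univ l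
    simp only [hT00, hT01, hT10, hT11, Finset.mem_union, Finset.mem_filter, Finset.mem_univ,
      true_and] at hl
    have hx : e 0 1 l - e 0 0 l ≠ 0 := by
      intro h
      rcases hl with ((h' | h') | h') | h' <;> linarith [h'.1]
    have hy : e 1 1 l - e 1 0 l ≠ 0 := by
      intro h
      rcases hl with ((h' | h') | h') | h' <;> linarith [h'.2]
    obtain ⟨hsign, hval⟩ := opposite_signs_of_segment_eq_zero hx hy h0 h1 hq
    simp only [hS, Finset.mem_insert, Finset.mem_image]
    exact Or.inr (Or.inr ⟨l, (hbreak l).2 hsign, by rw [hpl', hval]⟩)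
  have hpay : ∀ i T, payoff i T = e0 i + ∑ l, e i 0 l + ∑ l ∈ T, (e i 1 l - e i 0 l) := by
    intro i T
    rw [hpayoff, ← Finset.sum_add_sum_compl T (e i 0), Finset.sum_sub_distrib]
    ring
  have hmix : ∀ q T, (1 - q) * payoff 0 T + q * payoff 1 T =
      (1 - q) * (e0 0 + ∑ l, e 0 0 l) + q * (e0 1 + ∑ l, e 1 0 l) + ∑ l ∈ T, d l q := by
    intro q T
    simp only [hpay, hd, Finset.sum_add_distrib, ← Finset.mul_sum]
    ring
  have hVle : ∀ q T, V q ≤ (1 - q) * payoff 0 T + q * payoff 1 T := fun q T => by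
    rw [hV]
    exact Finset.inf'_le _ (Finset.mem_univ T)
  have hVge : ∀ q T, (∀ l ∈ T, d l q ≤ 0) → (∀ l ∉ T, 0 ≤ d l q) →
      (1 - q) * payoff 0 T + q * payoff 1 T ≤ V q := by
    intro q T hT hTc
    rw [hV]
    refine Finset.le_inf' _ _ fun T' _ => ?_
    rw [hmix, hmix]
    linarith [sum_le_sum_of_sign hT hTc T']
  constructor
  · obtain ⟨q, hq, hqV⟩ := Finset.exists_mem_eq_sup' (s := S) (Finset.insert_nonempty _ _) V
    exact ⟨q, hS01 q hq, hqV.symm⟩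
  · rintro _ ⟨p, ⟨hp0, hp1⟩, rfl⟩
    by_cases hpS : p ∈ S
    · exact Finset.le_sup' V hpS
    have h0S : (0 : ℝ) ∈ S := by simp [hS]
    have h1S : (1 : ℝ) ∈ S := by simp [hS]
    obtain ⟨a, ha, hamax⟩ := (S.filter (· < p)).exists_max_image id
      ⟨0, Finset.mem_filter.2 ⟨h0S, lt_of_le_of_ne hp0 fun h => hpS (h ▸ h0S)⟩⟩
    obtain ⟨b, hb, hbmin⟩ := (S.filter (p < ·)).exists_min_image id
      ⟨1, Finset.mem_filter.2 ⟨h1S, lt_of_le_of_ne hp1 fun h => hpS (h ▸ h1S)⟩⟩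
    obtain ⟨haS, hap⟩ := Finset.mem_filter.1 ha
    obtain ⟨hbS, hpb⟩ := Finset.mem_filter.1 hb
    have hgap : ∀ q, a < q → q < b → q ∉ S := by
      intro q haq hqb hqS
      rcases lt_trichotomy q p with h | h | h
      · exact (hamax q (Finset.mem_filter.2 ⟨hqS, h⟩)).not_gt haq
      · exact hpS (h ▸ hqS)
      · exact (hbmin q (Finset.mem_filter.2 ⟨hqS, h⟩)).not_gt hqb
    have hne : ∀ l q, a < q → q < b → d l q ≠ 0 := fun l q haq hqb h =>
      hgap q haq hqb (hzero l q ((hS01 a haS).1.trans haq.le) (hqb.le.trans (hS01 b hbS).2) h)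
    have hcont : ∀ l, Continuous (d l) := fun l => by
      simp only [hd]; fun_prop
    set T : Finset (Fin n) := Finset.univ.filter fun l => d l p ≤ 0 with hT
    have hin : ∀ l ∈ T, d l a ≤ 0 ∧ d l b ≤ 0 := fun l hl =>
      nonpos_endpoints_of_ne_zero (hcont l) hap hpb (hne l) (Finset.mem_filter.1 hl).2
    have hout : ∀ l ∉ T, 0 ≤ d l a ∧ 0 ≤ d l b := by
      intro l hl
      have hlp : -d l p ≤ 0 := by
        simp only [hT, Finset.mem_filter, Finset.mem_univ, true_and, not_le] at hl
        linarith
      have h := nonpos_endpoints_of_ne_zero (hcont l).neg hap hpb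
        (fun q haq hqb => neg_ne_zero.2 (hne l q haq hqb)) hlp
      exact ⟨neg_nonpos.1 h.1, neg_nonpos.1 h.2⟩
    calc V p ≤ (1 - p) * payoff 0 T + p * payoff 1 T := hVle p T
      _ ≤ max ((1 - a) * payoff 0 T + a * payoff 1 T) ((1 - b) * payoff 0 T + b * payoff 1 T) :=
        affine_le_max_endpoints _ _ hap.le hpb.le
      _ ≤ max (V a) (V b) := max_le_max
        (hVge a T (fun l hl => (hin l hl).1) fun l hl => (hout l hl).1)
        (hVge b T (fun l hl => (hin l hl).2) fun l hl => (hout l hl).2)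
      _ ≤ _ := max_le (Finset.le_sup' V haS) (Finset.le_sup' V hbS)
end

section
/- Define f(d) := −2(80d³ − 832d² + 135d − 2) / ((52d − 5)(840d² − 114d + 1)) for positive integers d. Then f(d) > 0 for every integer d with 1 ≤ d ≤ 10, and f(d) < 0 for every integer d ≥ 11. -/
/-- Sign of `b₃₁(3,3,6)` in Model B3: with
`f(d) = −2(80d³ − 832d² + 135d − 2)/((52d − 5)(840d² − 114d + 1))`,
one has `f(d) > 0` for `1 ≤ d ≤ 10` and `f(d) < 0` for `d ≥ 11`. -/
theorem stmt_4 (f : ℕ → ℝ)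
    (hf : ∀ d : ℕ, 0 < d → f d =
      -2 * (80 * (d : ℝ) ^ 3 - 832 * (d : ℝ) ^ 2 + 135 * (d : ℝ) - 2)
        / ((52 * (d : ℝ) - 5) * (840 * (d : ℝ) ^ 2 - 114 * (d : ℝ) + 1))) :
    (∀ d : ℕ, 1 ≤ d → d ≤ 10 → 0 < f d) ∧ (∀ d : ℕ, 11 ≤ d → f d < 0) := by
  refine ⟨fun d h1 h2 => ?_, fun d h => ?_⟩
  · rw [hf d h1]
    interval_cases d <;> norm_num
  · rw [hf d (by omega)]
    have hd : (11 : ℝ) ≤ d := by exact_mod_cast h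
    have hcubic : 0 < 80 * (d : ℝ) ^ 3 - 832 * (d : ℝ) ^ 2 + 135 * (d : ℝ) - 2 := by
      nlinarith [mul_nonneg (sq_nonneg (d : ℝ)) (sub_nonneg.2 hd)]
    have hquad : 0 < 840 * (d : ℝ) ^ 2 - 114 * (d : ℝ) + 1 := by nlinarith
    exact div_neg_of_neg_of_pos (by linarith) (mul_pos (by linarith) hquad)
end

section
/- Define h(d) := −(15360d⁴ − 45184d³ + 9040d² − 588d + 13) / ((52d − 5)(26880d³ − 4680d² + 242d − 3)) for positive integers d. Then h(d) < 0 for every integer d ≥ 3, and h(d) > 0 for d = 1 and d = 2. -/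
/-- Sign of `b₁(5,4)` in Model B1: with
`h(d) = −(15360d⁴ − 45184d³ + 9040d² − 588d + 13)/((52d − 5)(26880d³ − 4680d² + 242d − 3))`,
one has `h(d) < 0` for every integer `d ≥ 3` and `h(d) > 0` for `d = 1, 2`. -/
theorem stmt_6 (h : ℕ → ℝ)
    (hh : ∀ d : ℕ, 0 < d → h d =
      -(15360 * (d : ℝ) ^ 4 - 45184 * (d : ℝ) ^ 3 + 9040 * (d : ℝ) ^ 2
          - 588 * (d : ℝ) + 13)
        / ((52 * (d : ℝ) - 5)
          * (26880 * (d : ℝ) ^ 3 - 4680 * (d : ℝ) ^ 2 + 242 * (d : ℝ) - 3))) :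
    (∀ d : ℕ, 3 ≤ d → h d < 0) ∧ 0 < h 1 ∧ 0 < h 2 := by
  refine ⟨fun d hd => ?_, ?_, ?_⟩
  · rw [hh d (by omega)]
    obtain ⟨n, rfl⟩ := Nat.exists_eq_add_of_le' hd
    push_cast
    apply div_neg_of_neg_of_pos
    · rw [neg_lt_zero]
      ring_nf
      positivity
    · apply mul_pos
      · ring_nf
        positivity
      · ring_nf
        positivity
  · rw [hh 1 one_pos]
    norm_num
  · rw [hh 2 two_pos]
    norm_num
end

section
/- For an integer d ≥ 4, let (52d)_6 := 52d(52d−1)(52d−2)(52d−3)(52d−4)(52d−5) and define the 2×2 matrix A(d) with entries A₀₀ = (−64d²)·4(1168384d⁴ − 284720d³ + 22320d² − 446d − 11)/(52d)_6, A₀₁ = (−64d²)·(2756608d⁴ − 470336d³ + 4656d² + 3072d − 159)/(52d)_6, A₁₀ = (−64d²)·2(1896960d⁴ − 461984d³ + 39392d² − 1266d + 9)/(52d)_6, A₁₁ = (−64d²)·(4219904d⁴ − 954112d³ + 68384d² − 852d − 57)/(52d)_6. With p_d := (36864d³ − 9312d² + 732d − 23)/(8(5632d³ − 1138d² + 69d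 − 1)) and v_d := −16d²(89072336896d⁷ − 38873874432d⁶ + 6969345536d⁵ − 655761920d⁴ + 34638784d³ − 1090952d² + 26286d − 537)/[(5632d³ − 1138d² + 69d − 1)(52d)_6], one has the indifference identities (1 − p_d)A₀₀ + p_d·A₁₀ = v_d and (1 − p_d)A₀₁ + p_d·A₁₁ = v_d, and moreover 0 < p_d < 1. -/
/-- A convex combination with weight `n / (8 * q)` of two fractions with common denominator `F`,
evaluated from the corresponding identity between numerators. -/
theorem mix_eq_of_numerators {n q F x a c w : ℝ} (hq : q ≠ 0) (hF : F ≠ 0)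
    (h : (8 * q - n) * a + n * c = 2 * w) :
    (1 - n / (8 * q)) * (-64 * x * a / F) + n / (8 * q) * (-64 * x * c / F)
      = -16 * x * w / (q * F) := by
  field_simp
  linear_combination (-64 * x) * h

/-- Indifference identities for Player's optimal mixed strategy `(1 − p_d, p_d)` against
the two columns of the Model B1 kernel `A(d)` for `d ≥ 4` decks, with game value `v_d`;
moreover `0 < p_d < 1`. -/
theorem stmt_8 (d : ℕ) (hd : 4 ≤ d) :
    let D : ℝ := (d : ℝ)
    let F : ℝ := 52 * D * (52 * D - 1) * (52 * D - 2) * (52 * D - 3)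
      * (52 * D - 4) * (52 * D - 5)
    let A00 : ℝ := (-64 * D ^ 2)
      * (4 * (1168384 * D ^ 4 - 284720 * D ^ 3 + 22320 * D ^ 2 - 446 * D - 11)) / F
    let A01 : ℝ := (-64 * D ^ 2)
      * (2756608 * D ^ 4 - 470336 * D ^ 3 + 4656 * D ^ 2 + 3072 * D - 159) / F
    let A10 : ℝ := (-64 * D ^ 2)
      * (2 * (1896960 * D ^ 4 - 461984 * D ^ 3 + 39392 * D ^ 2 - 1266 * D + 9)) / F
    let A11 : ℝ := (-64 * D ^ 2)
      * (4219904 * D ^ 4 - 954112 * D ^ 3 + 68384 * D ^ 2 - 852 * D - 57) / F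
    let p : ℝ := (36864 * D ^ 3 - 9312 * D ^ 2 + 732 * D - 23)
      / (8 * (5632 * D ^ 3 - 1138 * D ^ 2 + 69 * D - 1))
    let v : ℝ := -16 * D ^ 2
      * (89072336896 * D ^ 7 - 38873874432 * D ^ 6 + 6969345536 * D ^ 5
        - 655761920 * D ^ 4 + 34638784 * D ^ 3 - 1090952 * D ^ 2 + 26286 * D - 537)
      / ((5632 * D ^ 3 - 1138 * D ^ 2 + 69 * D - 1) * F)
    (1 - p) * A00 + p * A10 = v ∧ (1 - p) * A01 + p * A11 = v ∧ 0 < p ∧ p < 1 := by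
  intro D F A00 A01 A10 A11 p v
  have hD : (4 : ℝ) ≤ D := Nat.ofNat_le_cast.2 hd
  have hF : F ≠ 0 := by
    have h : 0 < F := by
      have h0 : 0 < 52 * D := by linarith
      have h1 : 0 < 52 * D - 1 := by linarith
      have h2 : 0 < 52 * D - 2 := by linarith
      have h3 : 0 < 52 * D - 3 := by linarith
      have h4 : 0 < 52 * D - 4 := by linarith
      have h5 : 0 < 52 * D - 5 := by linarith
      positivity
    exact h.ne'
  have hden : 0 < 5632 * D ^ 3 - 1138 * D ^ 2 + 69 * D - 1 := by
    nlinarith [mul_nonneg (sq_nonneg D) (sub_nonneg.2 hD)]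
  have hnum : 0 < 36864 * D ^ 3 - 9312 * D ^ 2 + 732 * D - 23 := by
    nlinarith [mul_nonneg (sq_nonneg D) (sub_nonneg.2 hD)]
  have hlt : 36864 * D ^ 3 - 9312 * D ^ 2 + 732 * D - 23
      < 8 * (5632 * D ^ 3 - 1138 * D ^ 2 + 69 * D - 1) := by
    nlinarith [mul_nonneg (sq_nonneg D) (sub_nonneg.2 hD), mul_nonneg (sub_nonneg.2 hD) (sub_nonneg.2 hD)]
  exact ⟨mix_eq_of_numerators hden.ne' hF (by ring), mix_eq_of_numerators hden.ne' hF (by ring),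
    by positivity, (div_lt_one (by positivity)).2 hlt⟩
end

section
/- For an integer d ≥ 4, with the 2×2 kernel A(d) of Model B1 defined by A₀₀ = (−64d²)·4(1168384d⁴ − 284720d³ + 22320d² − 446d − 11)/(52d)_6, A₀₁ = (−64d²)·(2756608d⁴ − 470336d³ + 4656d² + 3072d − 159)/(52d)_6, A₁₀ = (−64d²)·2(1896960d⁴ − 461984d³ + 39392d² − 1266d + 9)/(52d)_6, A₁₁ = (−64d²)·(4219904d⁴ − 954112d³ + 68384d² − 852d − 57)/(52d)_6, and with q_d := (439808d⁴ − 107456d³ + 5248d² + 374d − 31)/(4(52d − 5)(5632d³ − 1138d² + 69d − 1)) and v_d := −16d²(89072336896d⁷ − 38873874432d⁶ + 6969345536d⁵ − 655761920d⁴ + 34638784d³ − 1090952d² + 26286d − 537)/[(5632d³ − 1138d² + 69d − 1)(52d)_6], one has the indifference identities (1 − q_d)A₀₀ + q_d·A₀₁ = v_d and (1 − q_d)A₁₀ + q_d·A₁₁ = v_d, and moreover 0 < q_d < 1. -/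
/-- A mixture of `A / F` and `B / F` with weight `n / (4 * S * R)` on the latter equals
`V / (R * F)` once the identity obtained by clearing denominators holds. -/
theorem one_sub_div_mul_add_div_mul_eq {K : Type*} [Field K] [CharZero K] {n S R F A B V : K}
    (hS : S ≠ 0) (hR : R ≠ 0) (hF : F ≠ 0)
    (h : (4 * S * R - n) * A + n * B = 4 * S * V) :
    (1 - n / (4 * S * R)) * (A / F) + n / (4 * S * R) * (B / F) = V / (R * F) := by
  field_simp
  linear_combination h

/-- Indifference identities for Banker's optimal mixed strategy `(1 − q_d, q_d)` against
the two rows of the Model B1 kernel `A(d)` for `d ≥ 4` decks, with game value `v_d`;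
moreover `0 < q_d < 1`. -/
theorem stmt_9 (d : ℕ) (hd : 4 ≤ d) :
    let D : ℝ := (d : ℝ)
    let F : ℝ := 52 * D * (52 * D - 1) * (52 * D - 2) * (52 * D - 3)
      * (52 * D - 4) * (52 * D - 5)
    let A00 : ℝ := (-64 * D ^ 2)
      * (4 * (1168384 * D ^ 4 - 284720 * D ^ 3 + 22320 * D ^ 2 - 446 * D - 11)) / F
    let A01 : ℝ := (-64 * D ^ 2)
      * (2756608 * D ^ 4 - 470336 * D ^ 3 + 4656 * D ^ 2 + 3072 * D - 159) / F
    let A10 : ℝ := (-64 * D ^ 2)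
      * (2 * (1896960 * D ^ 4 - 461984 * D ^ 3 + 39392 * D ^ 2 - 1266 * D + 9)) / F
    let A11 : ℝ := (-64 * D ^ 2)
      * (4219904 * D ^ 4 - 954112 * D ^ 3 + 68384 * D ^ 2 - 852 * D - 57) / F
    let q : ℝ := (439808 * D ^ 4 - 107456 * D ^ 3 + 5248 * D ^ 2 + 374 * D - 31)
      / (4 * (52 * D - 5) * (5632 * D ^ 3 - 1138 * D ^ 2 + 69 * D - 1))
    let v : ℝ := -16 * D ^ 2
      * (89072336896 * D ^ 7 - 38873874432 * D ^ 6 + 6969345536 * D ^ 5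
        - 655761920 * D ^ 4 + 34638784 * D ^ 3 - 1090952 * D ^ 2 + 26286 * D - 537)
      / ((5632 * D ^ 3 - 1138 * D ^ 2 + 69 * D - 1) * F)
    (1 - q) * A00 + q * A01 = v ∧ (1 - q) * A10 + q * A11 = v ∧ 0 < q ∧ q < 1 := by
  intro D F A00 A01 A10 A11 q v
  obtain ⟨x, hx, hD⟩ : ∃ x : ℝ, 0 ≤ x ∧ D = x + 4 :=
    ⟨D - 4, sub_nonneg.2 (Nat.ofNat_le_cast.2 hd), by ring⟩
  have hF : F ≠ 0 := by
    have h0 : 0 < D := by linarith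
    have h1 : 0 < 52 * D - 1 := by linarith
    have h2 : 0 < 52 * D - 2 := by linarith
    have h3 : 0 < 52 * D - 3 := by linarith
    have h4 : 0 < 52 * D - 4 := by linarith
    have h5 : 0 < 52 * D - 5 := by linarith
    positivity
  have hS : 0 < 52 * D - 5 := by linarith
  have hR : 0 < 5632 * D ^ 3 - 1138 * D ^ 2 + 69 * D - 1 := by
    rw [hD]
    ring_nf
    positivity
  have hN : 0 < 439808 * D ^ 4 - 107456 * D ^ 3 + 5248 * D ^ 2 + 374 * D - 31 := by
    rw [hD]
    ring_nf
    positivity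
  have hlt : 439808 * D ^ 4 - 107456 * D ^ 3 + 5248 * D ^ 2 + 374 * D - 31
      < 4 * (52 * D - 5) * (5632 * D ^ 3 - 1138 * D ^ 2 + 69 * D - 1) := by
    rw [← sub_pos, hD]
    ring_nf
    positivity
  refine ⟨?_, ?_, by positivity, (div_lt_one (by positivity)).2 hlt⟩ <;>
  · refine one_sub_div_mul_add_div_mul_eq hS.ne' hR.ne' hF ?_
    ring
end

section
/- Define, for positive integers d, G(d) := 16d²(278921216d⁷ − 1057021952d⁶ + 410758144d⁵ − 67502464d⁴ + 5802464d³ − 276248d² + 7200d − 97)/[(5632d³ − 1138d² + 69d − 1)(52d)_6], where (52d)_6 := 52d(52d−1)(52d−2)(52d−3)(52d−4)(52d−5). Then G(d) > 0 for every integer d ≥ 4, and G(d) < 0 for d = 1, 2, 3. -/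
/-- Sign of the optimality-check quantity `G(d)` in the Model B1 solution:
`G(d) > 0` for every integer `d ≥ 4` and `G(d) < 0` for `d = 1, 2, 3`. -/
theorem stmt_10 (G : ℕ → ℝ)
    (hG : ∀ d : ℕ, 0 < d → G d =
      16 * (d : ℝ) ^ 2
        * (278921216 * (d : ℝ) ^ 7 - 1057021952 * (d : ℝ) ^ 6
          + 410758144 * (d : ℝ) ^ 5 - 67502464 * (d : ℝ) ^ 4
          + 5802464 * (d : ℝ) ^ 3 - 276248 * (d : ℝ) ^ 2 + 7200 * (d : ℝ) - 97)
        / ((5632 * (d : ℝ) ^ 3 - 1138 * (d : ℝ) ^ 2 + 69 * (d : ℝ) - 1)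
          * (52 * (d : ℝ) * (52 * (d : ℝ) - 1) * (52 * (d : ℝ) - 2)
            * (52 * (d : ℝ) - 3) * (52 * (d : ℝ) - 4) * (52 * (d : ℝ) - 5)))) :
    (∀ d : ℕ, 4 ≤ d → 0 < G d) ∧ G 1 < 0 ∧ G 2 < 0 ∧ G 3 < 0 := by
  refine ⟨fun d hd => ?_, ?_, ?_, ?_⟩
  · obtain ⟨k, rfl⟩ := Nat.exists_eq_add_of_le hd
    rw [hG _ (by lia)]
    push_cast
    have hk : (0 : ℝ) ≤ k := k.cast_nonneg
    generalize (k : ℝ) = x at hk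
    have hnum : 0 < 278921216 * (4 + x) ^ 7 - 1057021952 * (4 + x) ^ 6
        + 410758144 * (4 + x) ^ 5 - 67502464 * (4 + x) ^ 4
        + 5802464 * (4 + x) ^ 3 - 276248 * (4 + x) ^ 2 + 7200 * (4 + x) - 97 := by
      ring_nf
      positivity
    have hcubic : 0 < 5632 * (4 + x) ^ 3 - 1138 * (4 + x) ^ 2 + 69 * (4 + x) - 1 := by
      ring_nf
      positivity
    have h₁ : 0 < 52 * (4 + x) - 1 := by linarith
    have h₂ : 0 < 52 * (4 + x) - 2 := by linarith
    have h₃ : 0 < 52 * (4 + x) - 3 := by linarith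
    have h₄ : 0 < 52 * (4 + x) - 4 := by linarith
    have h₅ : 0 < 52 * (4 + x) - 5 := by linarith
    positivity
  all_goals
    rw [hG _ (by norm_num)]
    norm_num
end

section
/- Define, for positive integers d, W(d) := −32d(2783510528d⁷ − 1188571136d⁶ + 203128704d⁵ − 16568896d⁴ + 596408d³ − 16158d² + 1855d − 93)/[(352d² − 71d + 4)(52d)_6] and v(d) := −32d(11134042112d⁷ − 4259389440d⁶ + 648152320d⁵ − 49007232d⁴ + 1788256d³ − 14816d² − 1089d + 33)/[(1408d² − 220d + 9)(52d)_6], where (52d)_6 := 52d(52d−1)(52d−2)(52d−3)(52d−4)(52d−5). Then W(d) < v(d) for every integer d ≥ 20, and v(d) − W(d) → 0 as d → ∞. -/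
open Filter

/-- The numerator of `v(d) - W(d)` over the product of the denominators, divided by `32 * d`. -/
def gapNumerator (x : ℝ) : ℝ :=
  3941597184 * x ^ 8 - 2559975424 * x ^ 7 + 1592457472 * x ^ 6 - 388530944 * x ^ 5
    + 25130048 * x ^ 4 + 3712640 * x ^ 3 - 714137 * x ^ 2 + 43854 * x - 969

/-- The falling factorial `(52 x)₆`. -/
def deckFalling (x : ℝ) : ℝ :=
  52 * x * (52 * x - 1) * (52 * x - 2) * (52 * x - 3) * (52 * x - 4) * (52 * x - 5)

theorem deckFalling_pos {x : ℝ} (hx : 20 ≤ x) : 0 < deckFalling x := by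
  have h0 : 0 < 52 * x := by linarith
  have h1 : 0 < 52 * x - 1 := by linarith
  have h2 : 0 < 52 * x - 2 := by linarith
  have h3 : 0 < 52 * x - 3 := by linarith
  have h4 : 0 < 52 * x - 4 := by linarith
  have h5 : 0 < 52 * x - 5 := by linarith
  unfold deckFalling
  positivity

theorem denominatorW_pos {x : ℝ} (hx : 20 ≤ x) : 0 < 352 * x ^ 2 - 71 * x + 4 := by
  nlinarith

theorem denominatorV_pos {x : ℝ} (hx : 20 ≤ x) : 0 < 1408 * x ^ 2 - 220 * x + 9 := by
  nlinarith

theorem gapNumerator_pos {x : ℝ} (hx : 20 ≤ x) : 0 < gapNumerator x := by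
  obtain ⟨y, hy, rfl⟩ : ∃ y : ℝ, 0 ≤ y ∧ x = y + 20 := ⟨x - 20, by linarith, by ring⟩
  unfold gapNumerator
  ring_nf
  positivity

theorem gap_le_inv {x : ℝ} (hx : 20 ≤ x) :
    32 * x * gapNumerator x / ((352 * x ^ 2 - 71 * x + 4) * (1408 * x ^ 2 - 220 * x + 9)
      * deckFalling x) ≤ x⁻¹ := by
  have hD := deckFalling_pos hx
  have h1 := denominatorW_pos hx
  have h2 := denominatorV_pos hx
  have hx0 : 0 < x := by linarith
  rw [inv_eq_one_div, div_le_div_iff₀ (by positivity) hx0, ← sub_nonneg]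
  clear hD h1 h2 hx0
  obtain ⟨y, hy, rfl⟩ : ∃ y : ℝ, 0 ≤ y ∧ x = y + 20 := ⟨x - 20, by linarith, by ring⟩
  unfold gapNumerator deckFalling
  ring_nf
  positivity

/-- In the Model B2 analysis, the lower-envelope value `W(d) = V(p₂₂)` at the breakpoint
`p(8,8,∅)` is less than the value `v(d) = V(p₁₇)` at `p(0,6,∅)` for every integer
`d ≥ 20`, and `v(d) − W(d) → 0` as `d → ∞`. -/
theorem stmt_13 (W v : ℕ → ℝ)
    (hW : ∀ d : ℕ, 0 < d → W d =
      -32 * (d : ℝ)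
        * (2783510528 * (d : ℝ) ^ 7 - 1188571136 * (d : ℝ) ^ 6
          + 203128704 * (d : ℝ) ^ 5 - 16568896 * (d : ℝ) ^ 4
          + 596408 * (d : ℝ) ^ 3 - 16158 * (d : ℝ) ^ 2 + 1855 * (d : ℝ) - 93)
        / ((352 * (d : ℝ) ^ 2 - 71 * (d : ℝ) + 4)
          * (52 * (d : ℝ) * (52 * (d : ℝ) - 1) * (52 * (d : ℝ) - 2)
            * (52 * (d : ℝ) - 3) * (52 * (d : ℝ) - 4) * (52 * (d : ℝ) - 5))))
    (hv : ∀ d : ℕ, 0 < d → v d =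
      -32 * (d : ℝ)
        * (11134042112 * (d : ℝ) ^ 7 - 4259389440 * (d : ℝ) ^ 6
          + 648152320 * (d : ℝ) ^ 5 - 49007232 * (d : ℝ) ^ 4
          + 1788256 * (d : ℝ) ^ 3 - 14816 * (d : ℝ) ^ 2 - 1089 * (d : ℝ) + 33)
        / ((1408 * (d : ℝ) ^ 2 - 220 * (d : ℝ) + 9)
          * (52 * (d : ℝ) * (52 * (d : ℝ) - 1) * (52 * (d : ℝ) - 2)
            * (52 * (d : ℝ) - 3) * (52 * (d : ℝ) - 4) * (52 * (d : ℝ) - 5)))) :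
    (∀ d : ℕ, 20 ≤ d → W d < v d) ∧
    Tendsto (fun d : ℕ => v d - W d) atTop (nhds 0) := by
  have cast_le : ∀ {d : ℕ}, 20 ≤ d → (20 : ℝ) ≤ d := fun h => by exact_mod_cast h
  have gap : ∀ d : ℕ, 20 ≤ d → v d - W d =
      32 * (d : ℝ) * gapNumerator d / ((352 * (d : ℝ) ^ 2 - 71 * (d : ℝ) + 4)
        * (1408 * (d : ℝ) ^ 2 - 220 * (d : ℝ) + 9) * deckFalling d) := by
    intro d hd
    rw [hv d (by omega), hW d (by omega)]
    have hD := (deckFalling_pos (cast_le hd)).ne'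
    have h1 := (denominatorW_pos (cast_le hd)).ne'
    have h2 := (denominatorV_pos (cast_le hd)).ne'
    rw [← deckFalling]
    generalize deckFalling (d : ℝ) = D at *
    rw [div_sub_div _ _ (mul_ne_zero h2 hD) (mul_ne_zero h1 hD),
      div_eq_div_iff (mul_ne_zero (mul_ne_zero h2 hD) (mul_ne_zero h1 hD))
        (mul_ne_zero (mul_ne_zero h1 h2) hD), gapNumerator]
    ring
  have gap_pos : ∀ d : ℕ, 20 ≤ d → 0 < v d - W d := by
    intro d hd
    have hx := cast_le hd
    have hx0 : (0 : ℝ) < d := by linarith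
    rw [gap d hd]
    exact div_pos (mul_pos (by positivity) (gapNumerator_pos hx))
      (mul_pos (mul_pos (denominatorW_pos hx) (denominatorV_pos hx)) (deckFalling_pos hx))
  refine ⟨fun d hd => sub_pos.mp (gap_pos d hd), ?_⟩
  refine tendsto_of_tendsto_of_tendsto_of_le_of_le' tendsto_const_nhds
    (tendsto_inv_atTop_nhds_zero_nat (𝕜 := ℝ)) ?_ ?_
  · filter_upwards [eventually_ge_atTop 20] with d hd using (gap_pos d hd).le
  · filter_upwards [eventually_ge_atTop 20] with d hd
    rw [gap d hd]
    exact gap_le_inv (cast_le hd)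
end

section
/- Define, for positive integers d, U(d) := −8(695877632d⁷ − 281198592d⁶ + 34472064d⁵ + 1177024d⁴ − 901592d³ + 119896d² − 6755d + 123)/[(22d − 3)(52d)_6] and v(d) := −2(1391755264d⁷ − 500535296d⁶ + 54174464d⁵ + 1931136d⁴ − 948816d³ + 85792d² − 3238d + 41)/[(11d − 1)(52d)_6], where (52d)_6 := 52d(52d−1)(52d−2)(52d−3)(52d−4)(52d−5). Then U(d) < v(d) for every integer d ≥ 10, and v(d) − U(d) → 0 as d → ∞. -/
open Filter

/-- Numerator of the difference `v(d) - U(d)` over the common denominator. -/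
def diffNum (x : ℝ) : ℝ :=
  61587456 * x ^ 7 - 103757824 * x ^ 6 + 67878400 * x ^ 5 - 35421568 * x ^ 4
    + 8295840 * x ^ 3 - 896384 * x ^ 2 + 43632 * x - 738

/-- Common denominator of `v(d)` and `U(d)`. -/
def diffDen (x : ℝ) : ℝ :=
  (22 * x - 3) * (11 * x - 1)
    * (52 * x * (52 * x - 1) * (52 * x - 2) * (52 * x - 3) * (52 * x - 4) * (52 * x - 5))

theorem diffNum_pos {x : ℝ} (hx : 10 ≤ x) : 0 < diffNum x := by
  obtain ⟨y, hy, rfl⟩ : ∃ y : ℝ, 0 ≤ y ∧ x = y + 10 := ⟨x - 10, by linarith, by ring⟩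
  unfold diffNum
  ring_nf
  positivity

theorem diffDen_pos {x : ℝ} (hx : 10 ≤ x) : 0 < diffDen x := by
  have h : ∀ {a b : ℝ}, 11 ≤ a → b ≤ 5 → 0 < a * x - b := fun ha hb => by nlinarith
  unfold diffDen
  have h₁ : 0 < 22 * x - 3 := h (by norm_num) (by norm_num)
  have h₂ : 0 < 11 * x - 1 := h (by norm_num) (by norm_num)
  have h₃ : 0 < 52 * x - 1 := h (by norm_num) (by norm_num)
  have h₄ : 0 < 52 * x - 2 := h (by norm_num) (by norm_num)
  have h₅ : 0 < 52 * x - 3 := h (by norm_num) (by norm_num)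
  have h₆ : 0 < 52 * x - 4 := h (by norm_num) (by norm_num)
  have h₇ : 0 < 52 * x - 5 := h (by norm_num) (by norm_num)
  positivity

theorem mul_diffNum_le_diffDen {x : ℝ} (hx : 10 ≤ x) : x * diffNum x ≤ diffDen x := by
  obtain ⟨y, hy, rfl⟩ : ∃ y : ℝ, 0 ≤ y ∧ x = y + 10 := ⟨x - 10, by linarith, by ring⟩
  rw [← sub_nonneg]
  unfold diffNum diffDen
  ring_nf
  positivity

/-- In the Model B3 analysis, the lower-envelope value `U(d) = V(p₆)` at the breakpoint
`p(8,8,∅)` is less than the value `v(d) = V(p₁)` at `p(0,6,∅)` for every integer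
`d ≥ 10`, and `v(d) − U(d) → 0` as `d → ∞`. -/
theorem stmt_15 (U v : ℕ → ℝ)
    (hU : ∀ d : ℕ, 0 < d → U d =
      -8 * (695877632 * (d : ℝ) ^ 7 - 281198592 * (d : ℝ) ^ 6
          + 34472064 * (d : ℝ) ^ 5 + 1177024 * (d : ℝ) ^ 4
          - 901592 * (d : ℝ) ^ 3 + 119896 * (d : ℝ) ^ 2 - 6755 * (d : ℝ) + 123)
        / ((22 * (d : ℝ) - 3)
          * (52 * (d : ℝ) * (52 * (d : ℝ) - 1) * (52 * (d : ℝ) - 2)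
            * (52 * (d : ℝ) - 3) * (52 * (d : ℝ) - 4) * (52 * (d : ℝ) - 5))))
    (hv : ∀ d : ℕ, 0 < d → v d =
      -2 * (1391755264 * (d : ℝ) ^ 7 - 500535296 * (d : ℝ) ^ 6
          + 54174464 * (d : ℝ) ^ 5 + 1931136 * (d : ℝ) ^ 4
          - 948816 * (d : ℝ) ^ 3 + 85792 * (d : ℝ) ^ 2 - 3238 * (d : ℝ) + 41)
        / ((11 * (d : ℝ) - 1)
          * (52 * (d : ℝ) * (52 * (d : ℝ) - 1) * (52 * (d : ℝ) - 2)
            * (52 * (d : ℝ) - 3) * (52 * (d : ℝ) - 4) * (52 * (d : ℝ) - 5)))) :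
    (∀ d : ℕ, 10 ≤ d → U d < v d) ∧
    Tendsto (fun d : ℕ => v d - U d) atTop (nhds 0) := by
  have hx : ∀ {d : ℕ}, 10 ≤ d → (10 : ℝ) ≤ d := fun hd => by exact_mod_cast hd
  have hdiff : ∀ d : ℕ, 10 ≤ d → v d - U d = diffNum d / diffDen d := by
    intro d hd
    have hden := (diffDen_pos (hx hd)).ne'
    have h := hden
    unfold diffDen at h
    obtain ⟨hab, hc⟩ := mul_ne_zero_iff.mp h
    obtain ⟨ha, hb⟩ := mul_ne_zero_iff.mp hab
    rw [hU d (by omega), hv d (by omega), div_sub_div _ _ (mul_ne_zero hb hc) (mul_ne_zero ha hc),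
      div_eq_div_iff (mul_ne_zero (mul_ne_zero hb hc) (mul_ne_zero ha hc)) hden]
    unfold diffNum diffDen
    ring
  constructor
  · intro d hd
    rw [← sub_pos, hdiff d hd]
    exact div_pos (diffNum_pos (hx hd)) (diffDen_pos (hx hd))
  · refine squeeze_zero' ?_ ?_ (tendsto_inv_atTop_nhds_zero_nat (𝕜 := ℝ))
    · filter_upwards [eventually_ge_atTop 10] with d hd
      rw [hdiff d hd]
      exact (div_pos (diffNum_pos (hx hd)) (diffDen_pos (hx hd))).le
    · filter_upwards [eventually_ge_atTop 10] with d hd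
      have hd₀ : (0 : ℝ) < d := by linarith [hx hd]
      rw [hdiff d hd, div_le_iff₀ (diffDen_pos (hx hd)), inv_mul_eq_div, le_div_iff₀ hd₀, mul_comm]
      exact mul_diffNum_le_diffDen (hx hd)
end
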